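/- ⋆_c-SVD for 3-order tensors: for every A ∈ ℝ^{n1×n2×n3} there exist U ∈ ℝ^{n1×n2×n1}, S ∈ ℝ^{n1×n2×n3}, V ∈ ℝ^{n3×n2×n3} such that A = U ⋆_c (S ⋆_c Vᵀ), S[i1,i2,i3] = 0 whenever i1 ≠ i3, and U and V are orthogonal with respect to the ⋆_c-product: for every i = 1,…,n2 the matrices ((C)₂.U)[:,i,:] and ((C)₂.V)[:,i,:] are orthogonal matrices. -/

import Mathlib

open Matrix

/-- The discrete cosine transform matrix `C̄ ∈ ℝ^{n×n}` with (1-based) entries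
`C̄[i,j] = √((2 − δ_{i,1})/n)·cos((i−1)(2j−1)π/(2n))`. -/
noncomputable def dctBar (n : ℕ) : Matrix (Fin n) (Fin n) ℝ :=
  fun i j => Real.sqrt ((2 - if i.val = 0 then 1 else 0) / n) *
    Real.cos ((i.val : ℝ) * (2 * (j.val : ℝ) + 1) * Real.pi / (2 * n))

/-- The vector `c₁ ∈ ℝ^n` with `c₁[i] = 1/C̄[i,1]`. -/
noncomputable def cOne (n : ℕ) (hn : 1 ≤ n) : Fin n → ℝ :=
  fun i => 1 / dctBar n i ⟨0, hn⟩

/-- The matrix `C = diag(c₁)·C̄`. -/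
noncomputable def Cmat (n : ℕ) (hn : 1 ≤ n) : Matrix (Fin n) (Fin n) ℝ :=
  Matrix.diagonal (cOne n hn) * dctBar n

/-- The Toeplitz-plus-Hankel matrix `Th(a) ∈ ℝ^{n×n}` (1-based formula):
`Th(a)[i,j] = a[|i−j|+1] + (1 − δ_{i+j,n+1})·b_{ij}`, where `b_{ij} = a[i+j]`
if `i+j ≤ n` and `b_{ij} = a[2(n+1)−(i+j)]` if `i+j > n`.
Indices `i j : Fin n` correspond to 1-based indices `i.val+1`, `j.val+1`. -/
noncomputable def thMat {n : ℕ} (a : Fin n → ℝ) : Matrix (Fin n) (Fin n) ℝ :=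
  fun i j =>
    a ⟨i.val - j.val + (j.val - i.val), by have := i.isLt; have := j.isLt; omega⟩ +
    if hd : i.val + j.val + 1 = n then 0
    else if hle : i.val + j.val + 2 ≤ n then a ⟨i.val + j.val + 1, by omega⟩
    else a ⟨2 * n - 1 - (i.val + j.val), by have := i.isLt; have := j.isLt; omega⟩

/-- The unit upper bidiagonal matrix `Γ ∈ ℝ^{n×n}` with `Γ[i,i] = 1`,
`Γ[i,i+1] = 1` for `i < n`, and all other entries `0`. -/
def gammaMat (n : ℕ) : Matrix (Fin n) (Fin n) ℝ :=
  fun i j => if j.val = i.val then 1 else if j.val = i.val + 1 then 1 else 0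

/-- The `⋆_c`-product of 3-order tensors: with `Â = (Γ⁻¹)₂.A`, the mode-2 block
convolution with reflective boundary conditions
`Y[:,i,:] = Σ_j ( Â[:,|i−j|+1,:] + (1 − δ_{i+j,n2+1})·B_{ij} )·X[:,j,:]`,
whose mode-2 kernel is exactly `Th` applied to the mode-2 fibers of `Â`. -/
noncomputable def starc3 {n1 n2 l n3 : ℕ}
    (A : Fin n1 → Fin n2 → Fin l → ℝ) (X : Fin l → Fin n2 → Fin n3 → ℝ) :
    Fin n1 → Fin n2 → Fin n3 → ℝ :=
  fun i1 i i3 => ∑ m : Fin l, ∑ j : Fin n2,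
    thMat ((gammaMat n2)⁻¹ *ᵥ fun k => A i1 k m) i j * X m j i3

/-- The transpose of a 3-order tensor with respect to `⋆_c`:
`Bᵀ[i1,i2,i3] = B[i3,i2,i1]`. -/
def ctransp3 {p n2 q : ℕ} (B : Fin p → Fin n2 → Fin q → ℝ) :
    Fin q → Fin n2 → Fin p → ℝ :=
  fun i1 i2 i3 => B i3 i2 i1

theorem Fin.sum_mul_ite_of_iff_eq {n : ℕ} (f : Fin n → ℝ) {l : ℕ} (hl : l < n) (p : ℕ → Prop)
    [DecidablePred p] (hp : ∀ m < n, p m ↔ m = l) :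
    ∑ m : Fin n, f m * (if p m then 1 else 0) = f ⟨l, hl⟩ := by
  rw [Finset.sum_eq_single ⟨l, hl⟩]
  · simp [(hp l hl).2 rfl]
  · intro m _ hm
    simp [hp m m.isLt, Fin.ext_iff] at hm ⊢
    simp [hm]
  · simp

/-- The coefficient of `a m` in `thMat a i j`. -/
def reflectKernel (n m i j : ℕ) : ℝ :=
  (if i - j + (j - i) = m then 1 else 0) + (if i + j + 1 = m then 1 else 0) +
    (if i + j + 1 + m = 2 * n then 1 else 0)

theorem thMat_apply_eq_sum {n : ℕ} (a : Fin n → ℝ) (i j : Fin n) :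
    thMat a i j = ∑ m : Fin n, a m * reflectKernel n m i j := by
  have hi := i.isLt
  have hj := j.isLt
  have zero : ∀ (p : ℕ → Prop) [DecidablePred p],
      (∀ m < n, ¬ p m) → ∑ m : Fin n, a m * (if p m then 1 else 0) = 0 := by
    intro p _ hp
    simp [hp]
  simp only [thMat, reflectKernel, mul_add, Finset.sum_add_distrib]
  rw [add_assoc (Finset.sum _ _), Fin.sum_mul_ite_of_iff_eq a (by omega)
    (fun m => i.val - j.val + (j.val - i.val) = m) (fun m _ => eq_comm)]
  congr 1
  split_ifs with h1 h2
  · rw [zero (fun m => i.val + j.val + 1 = m) (by omega),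
      zero (fun m => i.val + j.val + 1 + m = 2 * n) (by omega), add_zero]
  · rw [Fin.sum_mul_ite_of_iff_eq a (by omega)
        (fun m => i.val + j.val + 1 = m) (fun m _ => eq_comm),
      zero (fun m => i.val + j.val + 1 + m = 2 * n) (by omega), add_zero]
  · rw [zero (fun m => i.val + j.val + 1 = m) (by omega),
      Fin.sum_mul_ite_of_iff_eq a (l := 2 * n - 1 - (i.val + j.val)) (by omega)
        (fun m => i.val + j.val + 1 + m = 2 * n) (by omega), zero_add]

/-- The eigenvalue of `reflectKernel n m` for the `k`-th cosine vector. -/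
noncomputable def cosSymbol (n m k : ℕ) : ℝ :=
  if m = 0 then 1 else 2 * Real.cos (m * (k * Real.pi / n))

theorem sum_cos_mul_reflectKernel {n m : ℕ} (hm : m ≤ n) (k : ℕ) (j : Fin n) :
    ∑ i : Fin n, Real.cos (k * (2 * (i.val : ℝ) + 1) * Real.pi / (2 * n)) *
        reflectKernel n m i j =
      cosSymbol n m k * Real.cos (k * (2 * (j.val : ℝ) + 1) * Real.pi / (2 * n)) := by
  have hj := j.isLt
  have hn : (n : ℝ) ≠ 0 := by
    have : n ≠ 0 := by omega
    exact_mod_cast this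
  set f : ℕ → ℝ := fun i => Real.cos (k * (2 * (i : ℝ) + 1) * Real.pi / (2 * n)) with hf
  have key : ∀ (l : ℕ) (_ : l < n) (p : ℕ → Prop) [DecidablePred p],
      (∀ i < n, p i ↔ i = l) → ∑ i : Fin n, f i * (if p i then 1 else 0) = f l :=
    fun l hl p _ hp => Fin.sum_mul_ite_of_iff_eq (fun i : Fin n => f i) hl p hp
  change ∑ i : Fin n, f i * reflectKernel n m i j = cosSymbol n m k * f j
  rcases Nat.eq_zero_or_pos m with rfl | hm0
  · rw [← key j hj (fun i => i = j.val) (fun _ _ => Iff.rfl), cosSymbol, if_pos rfl, one_mul]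
    refine Finset.sum_congr rfl fun i _ => ?_
    have hi := i.isLt
    have h1 : i.val - j.val + (j.val - i.val) = 0 ↔ i.val = j.val := by omega
    have h2 : ¬ i.val + j.val + 1 + 0 = 2 * n := by omega
    simp only [reflectKernel, h1, h2]
    simp
  · have split : ∀ i : Fin n, reflectKernel n m i j =
        (if i.val = j.val + m ∨ i.val + j.val + 1 + m = 2 * n then 1 else 0) +
        (if i.val + m = j.val ∨ i.val + j.val + 1 = m then 1 else 0) := by
      intro i
      have hi := i.isLt
      unfold reflectKernel
      split_ifs <;> first | omega | norm_num
    simp only [split, mul_add, Finset.sum_add_distrib]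
    have hplus : ∑ i : Fin n, f i *
        (if i.val = j.val + m ∨ i.val + j.val + 1 + m = 2 * n then 1 else 0) =
        Real.cos (k * (2 * (j.val : ℝ) + 1) * Real.pi / (2 * n) + m * (k * Real.pi / n)) := by
      by_cases h : j.val + m < n
      · rw [key (j.val + m) h (fun i => i = j.val + m ∨ i + j.val + 1 + m = 2 * n) (by omega)]
        simp only [hf]
        congr 1
        push_cast
        field_simp
        ring
      · rw [key (2 * n - 1 - m - j.val) (by omega)
          (fun i => i = j.val + m ∨ i + j.val + 1 + m = 2 * n) (by omega)]
        simp only [hf]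
        have hc : ((2 * n - 1 - m - j.val : ℕ) : ℝ) = 2 * n - 1 - m - j.val := by
          have : 2 * n - 1 - m - j.val + 1 + m + j.val = 2 * n := by omega
          have := congrArg (Nat.cast (R := ℝ)) this
          push_cast at this
          linarith
        rw [hc, ← Real.cos_nat_mul_two_pi_sub _ k]
        congr 1
        field_simp
        ring
    have hminus : ∑ i : Fin n, f i *
        (if i.val + m = j.val ∨ i.val + j.val + 1 = m then 1 else 0) =
        Real.cos (k * (2 * (j.val : ℝ) + 1) * Real.pi / (2 * n) - m * (k * Real.pi / n)) := by
      by_cases h : m ≤ j.val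
      · rw [key (j.val - m) (by omega) (fun i => i + m = j.val ∨ i + j.val + 1 = m) (by omega)]
        simp only [hf]
        rw [Nat.cast_sub h]
        congr 1
        field_simp
        ring
      · rw [key (m - (j.val + 1)) (by omega)
          (fun i => i + m = j.val ∨ i + j.val + 1 = m) (by omega)]
        simp only [hf]
        rw [Nat.cast_sub (by omega), ← Real.cos_neg]
        congr 1
        push_cast
        field_simp
        ring
    rw [hplus, hminus, Real.cos_add, Real.cos_sub, cosSymbol, if_neg hm0.ne']
    ring

theorem cos_half_index_ne_zero {n : ℕ} (k : Fin n) :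
    Real.cos (k.val * Real.pi / (2 * n)) ≠ 0 := by
  have hk : (k.val : ℝ) < n := by exact_mod_cast k.isLt
  have hn : (0 : ℝ) < n := lt_of_le_of_lt (Nat.cast_nonneg _) hk
  refine (Real.cos_pos_of_mem_Ioo ⟨?_, ?_⟩).ne'
  · have : 0 ≤ k.val * Real.pi / (2 * n) := by positivity
    linarith [Real.pi_pos]
  · rw [div_lt_div_iff₀ (by positivity) (by norm_num)]
    nlinarith [Real.pi_pos]

theorem Cmat_apply {n : ℕ} (hn : 1 ≤ n) (k i : Fin n) :
    Cmat n hn k i = Real.cos (k.val * (2 * (i.val : ℝ) + 1) * Real.pi / (2 * n)) /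
      Real.cos (k.val * Real.pi / (2 * n)) := by
  have hs : Real.sqrt ((2 - if k.val = 0 then 1 else 0) / n) ≠ 0 := by
    have : (0 : ℝ) < n := by exact_mod_cast hn
    refine (Real.sqrt_pos.2 (div_pos ?_ this)).ne'
    split_ifs <;> norm_num
  have hc := cos_half_index_ne_zero k
  simp only [Cmat, Matrix.diagonal_mul, cOne, dctBar]
  simp only [Nat.cast_zero, mul_zero, zero_add, mul_one]
  field_simp

theorem sum_Cmat_mul_reflectKernel {n m : ℕ} (hn : 1 ≤ n) (hm : m ≤ n) (k j : Fin n) :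
    ∑ i, Cmat n hn k i * reflectKernel n m i j = cosSymbol n m k * Cmat n hn k j := by
  simp only [Cmat_apply, div_mul_eq_mul_div, ← Finset.sum_div]
  rw [sum_cos_mul_reflectKernel hm, mul_div_assoc]

theorem Cmat_mul_gammaMat_apply {n : ℕ} (hn : 1 ≤ n) (k m : Fin n) :
    (Cmat n hn * gammaMat n) k m = cosSymbol n m k := by
  have hc := cos_half_index_ne_zero k
  have hn0 : (n : ℝ) ≠ 0 := by
    have : n ≠ 0 := by omega
    exact_mod_cast this
  rw [Matrix.mul_apply]
  rcases Nat.eq_zero_or_pos m.val with hm | hm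
  · rw [Finset.sum_eq_single m]
    · simp [gammaMat, Cmat_apply, cosSymbol, hm, hc]
    · intro i _ hi
      have : ¬ m.val = i.val := fun h => hi (Fin.ext h.symm)
      simp [gammaMat, this]
      omega
    · simp
  · rw [Finset.sum_eq_add_of_mem m ⟨m.val - 1, by omega⟩ (Finset.mem_univ _) (Finset.mem_univ _)]
    · have h1 : m.val = m.val - 1 + 1 := by omega
      have h2 : ¬ m.val = m.val - 1 := by omega
      simp only [gammaMat, Cmat_apply, cosSymbol, hm.ne', if_true, if_false, ← h1, h2, mul_one]
      rw [← add_div, div_eq_iff hc, Nat.cast_pred hm,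
        show (k.val : ℝ) * (2 * (m.val : ℝ) + 1) * Real.pi / (2 * n) =
          m * (k * Real.pi / n) + k.val * Real.pi / (2 * n) by field_simp,
        show (k.val : ℝ) * (2 * ((m.val : ℝ) - 1) + 1) * Real.pi / (2 * n) =
          m * (k * Real.pi / n) - k.val * Real.pi / (2 * n) by field_simp; ring,
        Real.cos_add, Real.cos_sub]
      ring
    · simp [Fin.ext_iff]
      omega
    · intro i _ ⟨hi1, hi2⟩
      have h1 : ¬ m.val = i.val := fun h => hi1 (Fin.ext h.symm)
      have h2 : ¬ m.val = i.val + 1 := fun h => hi2 (Fin.ext (by simp; omega))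
      simp [gammaMat, h1, h2]

theorem isUnit_det_gammaMat (n : ℕ) : IsUnit (gammaMat n).det := by
  rw [Matrix.det_of_isUpperTriangular]
  · simp [gammaMat]
  · intro i j hij
    have : j.val < i.val := hij
    have h1 : ¬ j.val = i.val := by omega
    have h2 : ¬ j.val = i.val + 1 := by omega
    simp [gammaMat, h1, h2]

theorem Cmat_mul_thMat {n : ℕ} (hn : 1 ≤ n) (a : Fin n → ℝ) :
    Cmat n hn * thMat ((gammaMat n)⁻¹ *ᵥ a) =
      Matrix.diagonal (Cmat n hn *ᵥ a) * Cmat n hn := by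
  set b := (gammaMat n)⁻¹ *ᵥ a with hb
  have ha : a = gammaMat n *ᵥ b := by
    rw [hb, Matrix.mulVec_mulVec, Matrix.mul_nonsing_inv _ (isUnit_det_gammaMat n),
      Matrix.one_mulVec]
  ext k j
  rw [ha, Matrix.mulVec_mulVec, Matrix.diagonal_mul, Matrix.mul_apply, Matrix.mulVec, dotProduct,
    Finset.sum_mul]
  simp only [thMat_apply_eq_sum, Finset.mul_sum, Cmat_mul_gammaMat_apply]
  rw [Finset.sum_comm]
  refine Finset.sum_congr rfl fun m _ => ?_
  rw [mul_right_comm, ← sum_Cmat_mul_reflectKernel hn m.isLt.le, Finset.sum_mul]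
  exact Finset.sum_congr rfl fun i _ => by ring

theorem isUnit_Cmat {n : ℕ} (hn : 1 ≤ n) : IsUnit (Cmat n hn) := by
  rw [← Matrix.linearIndependent_rows_iff_isUnit]
  have hn0 : (0 : ℝ) < n := by exact_mod_cast hn
  refine Module.End.eigenvectors_linearIndependent'
    (Matrix.vecMulLinear (Matrix.of fun i j : Fin n => reflectKernel n 1 i j) :
      Module.End ℝ (Fin n → ℝ))
    (fun k : Fin n => cosSymbol n 1 k) ?_ (Cmat n hn).row fun k => ?_
  · intro k l hkl
    have hmem : ∀ k : Fin n, (k.val : ℝ) * Real.pi / n ∈ Set.Icc 0 Real.pi := by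
      intro k
      have hk : (k.val : ℝ) ≤ n := by exact_mod_cast k.isLt.le
      refine ⟨by positivity, ?_⟩
      rw [div_le_iff₀ hn0, mul_comm]
      exact mul_le_mul_of_nonneg_left hk Real.pi_pos.le
    simp only [cosSymbol, one_ne_zero, if_false, Nat.cast_one, one_mul] at hkl
    have := Real.injOn_cos (hmem k) (hmem l) (mul_left_cancel₀ two_ne_zero hkl)
    rw [div_left_inj' hn0.ne', mul_left_inj' Real.pi_ne_zero] at this
    exact Fin.ext (by exact_mod_cast this)
  · refine ⟨Module.End.mem_eigenspace_iff.2 ?_, fun h => ?_⟩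
    · ext j
      simpa [Matrix.vecMul, dotProduct] using sum_Cmat_mul_reflectKernel hn hn k j
    · have := congrFun h ⟨0, hn⟩
      simp [Matrix.row, Cmat_apply, cos_half_index_ne_zero k] at this

/-- The `i`-th mode-2 slice of `(C)₂.T`. -/
noncomputable def cSlice {n p q : ℕ} (hn : 1 ≤ n) (T : Fin p → Fin n → Fin q → ℝ) (i : Fin n) :
    Matrix (Fin p) (Fin q) ℝ :=
  Matrix.of fun a b => (Cmat n hn *ᵥ fun k => T a k b) i

theorem cSlice_injective {n p q : ℕ} (hn : 1 ≤ n) :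
    Function.Injective (cSlice (p := p) (q := q) hn) := by
  intro T T' h
  have hinj := Matrix.mulVec_injective_of_isUnit (isUnit_Cmat hn)
  ext a k b
  exact congrFun (@hinj (fun k => T a k b) (fun k => T' a k b)
    (funext fun i => congrFun (congrFun (congrFun h i) a) b)) k

theorem exists_cSlice_eq {n p q : ℕ} (hn : 1 ≤ n) (M : Fin n → Matrix (Fin p) (Fin q) ℝ) :
    ∃ T : Fin p → Fin n → Fin q → ℝ, cSlice hn T = M ∧
      ∀ a b, (∀ i, M i a b = 0) → ∀ k, T a k b = 0 := by
  refine ⟨fun a k b => ((Cmat n hn)⁻¹ *ᵥ fun i => M i a b) k, ?_, ?_⟩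
  · ext i a b
    change (Cmat n hn *ᵥ ((Cmat n hn)⁻¹ *ᵥ fun i => M i a b)) i = M i a b
    rw [Matrix.mulVec_mulVec, Matrix.mul_nonsing_inv _
      ((Matrix.isUnit_iff_isUnit_det _).1 (isUnit_Cmat hn)), Matrix.one_mulVec]
  · intro a b h k
    simp [h, Matrix.mulVec, dotProduct]

theorem cSlice_starc3 {n p l q : ℕ} (hn : 1 ≤ n) (A : Fin p → Fin n → Fin l → ℝ)
    (X : Fin l → Fin n → Fin q → ℝ) (i : Fin n) :
    cSlice hn (starc3 A X) i = cSlice hn A i * cSlice hn X i := by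
  ext a b
  have hfib : (fun k => starc3 A X a k b) =
      ∑ m, thMat ((gammaMat n)⁻¹ *ᵥ fun k => A a k m) *ᵥ fun k => X m k b := by
    ext k
    simp [starc3, Matrix.mulVec, dotProduct]
  simp only [cSlice, Matrix.of_apply, Matrix.mul_apply]
  rw [hfib, Matrix.mulVec_sum, Finset.sum_apply]
  refine Finset.sum_congr rfl fun m _ => ?_
  rw [Matrix.mulVec_mulVec, Cmat_mul_thMat, ← Matrix.mulVec_mulVec, Matrix.mulVec_diagonal]

theorem LinearMap.exists_orthonormalBasis_svd {E F : Type*} [NormedAddCommGroup E]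
    [InnerProductSpace ℝ E] [FiniteDimensional ℝ E] [NormedAddCommGroup F]
    [InnerProductSpace ℝ F] [FiniteDimensional ℝ F] {m n : ℕ}
    (hE : Module.finrank ℝ E = n) (hF : Module.finrank ℝ F = m) (T : E →ₗ[ℝ] F) :
    ∃ (u : OrthonormalBasis (Fin m) ℝ F) (v : OrthonormalBasis (Fin n) ℝ E)
      (S : Matrix (Fin m) (Fin n) ℝ), (∀ i j, i.val ≠ j.val → S i j = 0) ∧
      ∀ j, T (v j) = ∑ i, S i j • u i := by
  have hsym := T.isPositive_adjoint_comp_self.isSymmetric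
  set v := hsym.eigenvectorBasis hE
  have hinner : ∀ i j, inner ℝ (T (v i)) (T (v j)) =
      if i = j then hsym.eigenvalues hE i else 0 := by
    intro i j
    rw [← LinearMap.adjoint_inner_left, ← LinearMap.comp_apply,
      hsym.apply_eigenvectorBasis hE i, inner_smul_left]
    simp [v, OrthonormalBasis.inner_eq_ite]
  have hrank : ∀ j : Fin n, m ≤ j.val → T (v j) = 0 := by
    intro j hj
    rw [← inner_self_eq_zero (𝕜 := ℝ), hinner, if_pos rfl, ← T.sq_singularValues_fin hE,
      T.singularValues_eq_zero_iff_le_finrank_range.2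
        ((Submodule.finrank_le _).trans (hF.trans_le hj))]
    simp
  let w : Fin m → F := fun i => if h : i.val < n then T (v ⟨i, h⟩) else 0
  have hw : Pairwise fun i j => inner ℝ (w i) (w j) = 0 := by
    intro i j hij
    simp only [w]
    split_ifs <;> simp [hinner, Fin.ext_iff, Fin.val_ne_of_ne hij]
  have hcard : Module.finrank ℝ F = Fintype.card (Fin m) := by simpa using hF
  let u := InnerProductSpace.gramSchmidtOrthonormalBasis hcard w
  have hu : ∀ i, w i = ‖w i‖ • u i := by
    intro i
    by_cases h : w i = 0
    · simp [h]
    · have := InnerProductSpace.gramSchmidtOrthonormalBasis_apply_of_orthogonal hcard hw h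
      simp only [u, this]
      simp [smul_smul, h]
  refine ⟨u, v, fun i j => if i.val = j.val then ‖w i‖ else 0, ?_, ?_⟩
  · intro i j h
    simp [h]
  · intro j
    by_cases hj : j.val < m
    · rw [Finset.sum_eq_single (⟨j, hj⟩ : Fin m)]
      · simpa [w] using hu ⟨j, hj⟩
      · intro i _ hi
        simp [Fin.ext_iff] at hi
        simp [hi]
      · simp
    · rw [hrank j (not_lt.1 hj), eq_comm]
      refine Finset.sum_eq_zero fun i _ => ?_
      have : i.val ≠ j.val := by omega
      simp [this]

theorem Matrix.exists_svd {m n : ℕ} (M : Matrix (Fin m) (Fin n) ℝ) :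
    ∃ U ∈ Matrix.orthogonalGroup (Fin m) ℝ, ∃ V ∈ Matrix.orthogonalGroup (Fin n) ℝ,
      ∃ S : Matrix (Fin m) (Fin n) ℝ, (∀ i j, i.val ≠ j.val → S i j = 0) ∧
        M = U * (S * Vᵀ) := by
  obtain ⟨u, v, S, hS, h⟩ := (Matrix.toEuclideanLin M).exists_orthonormalBasis_svd
    finrank_euclideanSpace_fin finrank_euclideanSpace_fin
  have hU := (EuclideanSpace.basisFun (Fin m) ℝ).toMatrix_orthonormalBasis_mem_unitary u
  have hV := (EuclideanSpace.basisFun (Fin n) ℝ).toMatrix_orthonormalBasis_mem_unitary v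
  refine ⟨_, hU, _, hV, S, hS, ?_⟩
  set U := (EuclideanSpace.basisFun (Fin m) ℝ).toBasis.toMatrix u
  set V := (EuclideanSpace.basisFun (Fin n) ℝ).toBasis.toMatrix v
  have hMV : M * V = U * S := by
    ext i j
    have := congrArg (fun x : EuclideanSpace ℝ (Fin m) => x i) (h j)
    simpa [Matrix.mul_apply, Matrix.mulVec, dotProduct, U, V, Module.Basis.toMatrix_apply,
      mul_comm] using this
  have hVV : V * Vᵀ = 1 := (Matrix.mem_orthogonalGroup_iff _ _).1 hV
  rw [← Matrix.mul_assoc, ← hMV, Matrix.mul_assoc, hVV, Matrix.mul_one]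

/-- `⋆_c`-SVD for 3-order tensors: every `A ∈ ℝ^{n1×n2×n3}` factors as
`A = U ⋆_c (S ⋆_c Vᵀ)` with `S` f-diagonal and `U, V` orthogonal with respect
to the `⋆_c`-product: for every `i`, the mode-2 slices `((C)₂.U)[:,i,:]` and
`((C)₂.V)[:,i,:]` are orthogonal matrices. -/
theorem starcSVD3 (n1 n2 n3 : ℕ) (hn : 1 ≤ n2) (A : Fin n1 → Fin n2 → Fin n3 → ℝ) :
    ∃ (U : Fin n1 → Fin n2 → Fin n1 → ℝ)
      (S : Fin n1 → Fin n2 → Fin n3 → ℝ)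
      (V : Fin n3 → Fin n2 → Fin n3 → ℝ),
      A = starc3 U (starc3 S (ctransp3 V)) ∧
      (∀ (i1 : Fin n1) (i2 : Fin n2) (i3 : Fin n3), i1.val ≠ i3.val → S i1 i2 i3 = 0) ∧
      (∀ i : Fin n2,
        (Matrix.of fun a b : Fin n1 => (Cmat n2 hn *ᵥ fun k => U a k b) i) *
            (Matrix.of fun a b : Fin n1 => (Cmat n2 hn *ᵥ fun k => U a k b) i)ᵀ = 1 ∧
        (Matrix.of fun a b : Fin n1 => (Cmat n2 hn *ᵥ fun k => U a k b) i)ᵀ *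
            (Matrix.of fun a b : Fin n1 => (Cmat n2 hn *ᵥ fun k => U a k b) i) = 1) ∧
      (∀ i : Fin n2,
        (Matrix.of fun a b : Fin n3 => (Cmat n2 hn *ᵥ fun k => V a k b) i) *
            (Matrix.of fun a b : Fin n3 => (Cmat n2 hn *ᵥ fun k => V a k b) i)ᵀ = 1 ∧
        (Matrix.of fun a b : Fin n3 => (Cmat n2 hn *ᵥ fun k => V a k b) i)ᵀ *
            (Matrix.of fun a b : Fin n3 => (Cmat n2 hn *ᵥ fun k => V a k b) i) = 1) := by
  choose MU hU MV hV MS hS hA using fun i => (cSlice hn A i).exists_svd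
  obtain ⟨U, rfl, -⟩ := exists_cSlice_eq hn MU
  obtain ⟨V, rfl, -⟩ := exists_cSlice_eq hn MV
  obtain ⟨S, rfl, hS0⟩ := exists_cSlice_eq hn MS
  refine ⟨U, S, V, cSlice_injective hn (funext fun i => ?_),
    fun i1 i2 i3 h => hS0 i1 i3 (fun i => hS i i1 i3 h) i2,
    fun i => ⟨(Matrix.mem_orthogonalGroup_iff _ _).1 (hU i),
      (Matrix.mem_orthogonalGroup_iff' _ _).1 (hU i)⟩,
    fun i => ⟨(Matrix.mem_orthogonalGroup_iff _ _).1 (hV i),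
      (Matrix.mem_orthogonalGroup_iff' _ _).1 (hV i)⟩⟩
  rw [cSlice_starc3, cSlice_starc3]
  exact hA i
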